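/- arXiv:2009.07952 — 2 statements merged into one kernel-verified Lean document; each statement's English description precedes it below -/
import Mathlib

section
/- Fix λ > 1, r > 0 and T > 0, and let μ_r = ⊗_{n≥1} N(0,r²) be the infinite product Gaussian measure on ℝ^{ℕ≥1}. Then for μ_r-almost every x̄ ∈ ℝ^{ℕ≥1} there exists a componentwise solution of the infinite mixed shell model on [0,T] with initial condition x̄. -/
open MeasureTheory ProbabilityTheory

/-- Coefficients of the infinite mixed shell model: `k n = λ ^ n` for `n ≥ 2`,
`k 0 = k 1 = 0`. -/
noncomputable def mixedK (lam : ℝ) (n : ℕ) : ℝ :=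
  if 2 ≤ n then lam ^ n else 0

/-- A componentwise solution of the infinite mixed shell model on `[0,T]` with initial
condition `x̄` (components indexed by `n ≥ 1`, convention `X_0 ≡ 0`). -/
def IsCwShellSolution (lam T : ℝ) (xbar : ℕ → ℝ) (X : ℕ → ℝ → ℝ) : Prop :=
  (∀ t, X 0 t = 0) ∧
  ∀ n, 1 ≤ n →
    ContinuousOn (X n) (Set.Icc (0 : ℝ) T) ∧
    ∀ t ∈ Set.Icc (0 : ℝ) T,
      X n t = xbar n + ∫ s in (0 : ℝ)..t,
        (mixedK lam n * (X (n - 1) s) ^ 2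
          - mixedK lam (n + 1) * X n s * X (n + 1) s
          - mixedK lam n * (X (n + 1) s) ^ 2
          + mixedK lam (n - 1) * X (n - 1) s * X n s)

open Function in
lemma measurable_update_update {ι : Type*} [DecidableEq ι] (i j : ι) :
    Measurable (fun p : (ι → ℝ) × ℝ × ℝ => update (update p.1 i p.2.1) j p.2.2) := by
  refine measurable_pi_iff.2 fun k => ?_
  by_cases hj : k = j
  · subst hj; simpa using measurable_snd.snd
  by_cases hi : k = i
  · subst hi; simpa [update_of_ne hj] using measurable_snd.fst
  · simp only [update_of_ne hj, update_of_ne hi]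
    fun_prop

open Function in
lemma map_update_update_infinitePi {ι : Type*} [DecidableEq ι] (γ : Measure ℝ)
    [IsProbabilityMeasure γ] {i j : ι} (hij : i ≠ j) :
    ((Measure.infinitePi fun _ : ι => γ).prod (γ.prod γ)).map
      (fun p => update (update p.1 i p.2.1) j p.2.2) = Measure.infinitePi fun _ : ι => γ := by
  have hmeas := measurable_update_update i j
  refine Measure.eq_infinitePi _ fun s t ht => ?_
  set t' : ι → Set ℝ := fun k => if k ∈ s then t k else Set.univ with ht'
  have hmt' : ∀ k, MeasurableSet (t' k) := fun k => by
    simp only [ht']; split_ifs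
    exacts [ht k, MeasurableSet.univ]
  have hpre : (fun p : (ι → ℝ) × ℝ × ℝ => update (update p.1 i p.2.1) j p.2.2) ⁻¹'
      Set.pi s t = Set.pi ((s.erase i).erase j : Finset ι) t' ×ˢ (t' i ×ˢ t' j) := by
    ext ⟨x, u, w⟩
    simp only [Set.mem_preimage, Set.mem_pi, Finset.mem_coe, Set.mem_prod, Finset.mem_erase, ht']
    constructor
    · intro h
      refine ⟨fun k hk => ?_, ?_, ?_⟩
      · have := h k hk.2.2
        rw [update_of_ne hk.1, update_of_ne hk.2.1] at this
        simpa [hk.2.2] using this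
      · split_ifs with hi
        · simpa [update_of_ne hij] using h i hi
        · trivial
      · split_ifs with hj
        · simpa using h j hj
        · trivial
    · rintro ⟨h1, h2, h3⟩ k hk
      by_cases hj : k = j
      · subst hj; simpa [hk] using h3
      by_cases hi : k = i
      · subst hi; simpa [hk, update_of_ne hj] using h2
      · simpa [update_of_ne hj, update_of_ne hi, hk] using h1 k ⟨hj, hi, hk⟩
  rw [Measure.map_apply hmeas (MeasurableSet.pi s.countable_toSet fun k _ => ht k), hpre,
    Measure.prod_prod, Measure.prod_prod, Measure.infinitePi_pi _ (fun k _ => hmt' k)]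
  have hs : ∏ k ∈ s, γ (t k) = ∏ k ∈ insert i (insert j ((s.erase i).erase j)), γ (t' k) := by
    have : ∏ k ∈ s, γ (t k) = ∏ k ∈ s, γ (t' k) :=
      Finset.prod_congr rfl fun k hk => by simp [ht', hk]
    rw [this]
    refine Finset.prod_subset (fun k hk => ?_) (fun k _ hk => by simp [ht', hk])
    simp only [Finset.mem_insert, Finset.mem_erase]
    tauto
  rw [hs, Finset.prod_insert (by simp [hij]), Finset.prod_insert (by simp)]
  ring

/-- Rotation of the coordinates `i`, `j` by a state-dependent angle. -/
noncomputable def planeRot {ι : Type*} [DecidableEq ι] (i j : ι) (φ : (ι → ℝ) → ℝ)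
    (x : ι → ℝ) : ι → ℝ :=
  Function.update (Function.update x i (Real.cos (φ x) * x i + Real.sin (φ x) * x j)) j
    (-Real.sin (φ x) * x i + Real.cos (φ x) * x j)

open Function in
lemma measurePreserving_planeRot {ι : Type*} [DecidableEq ι] (γ : Measure ℝ) [IsGaussian γ]
    (hγ : ∫ x, x ∂γ = 0) {i j : ι} (hij : i ≠ j) {φ : (ι → ℝ) → ℝ} (hφ : Measurable φ)
    (hφ' : ∀ x u w, φ (update (update x i u) j w) = φ x) :
    MeasurePreserving (planeRot i j φ) (Measure.infinitePi fun _ : ι => γ)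
      (Measure.infinitePi fun _ : ι => γ) := by
  set U : (ι → ℝ) × ℝ × ℝ → ι → ℝ := fun p => update (update p.1 i p.2.1) j p.2.2 with hU
  have hUm : Measurable U := measurable_update_update i j
  have hR : Measurable (planeRot i j φ) := by
    have : planeRot i j φ = U ∘ fun x => (x, Real.cos (φ x) * x i + Real.sin (φ x) * x j,
      -Real.sin (φ x) * x i + Real.cos (φ x) * x j) := rfl
    rw [this]
    exact hUm.comp (by fun_prop)
  have hK : MeasurePreserving
      (fun p : (ι → ℝ) × ℝ × ℝ => (p.1, ContinuousLinearMap.rotation (φ p.1) p.2))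
      ((Measure.infinitePi fun _ : ι => γ).prod (γ.prod γ))
      ((Measure.infinitePi fun _ : ι => γ).prod (γ.prod γ)) := by
    refine MeasurePreserving.skew_product (g := fun x w => ContinuousLinearMap.rotation (φ x) w)
      (MeasurePreserving.id _) ?_ ?_
    · simp only [ContinuousLinearMap.rotation_apply, Function.uncurry_def]
      fun_prop
    · exact Filter.Eventually.of_forall fun x =>
        IsGaussian.map_rotation_eq_self (by simpa using hγ) (φ x)
  refine ⟨hR, ?_⟩
  have hUP := map_update_update_infinitePi γ hij
  have hcomp : planeRot i j φ ∘ U =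
      U ∘ fun p => (p.1, ContinuousLinearMap.rotation (φ p.1) p.2) := by
    ext ⟨x, u, w⟩ k
    simp only [planeRot, Function.comp, hU, hφ', ContinuousLinearMap.rotation_apply]
    by_cases hj : k = j
    · subst hj; simp [update_of_ne hij]
    by_cases hi : k = i
    · subst hi; simp [update_of_ne hj]
    · simp [update_of_ne hj, update_of_ne hi]
  conv_lhs => rw [← hUP]
  rw [Measure.map_map hR hUm]
  change Measure.map (planeRot i j φ ∘ U) _ = _
  rw [hcomp, ← Measure.map_map hUm hK.measurable, hK.map_eq, hUP]

lemma eq_infinitePi_of_map_fin {γ : Measure ℝ} [IsProbabilityMeasure γ] {μ : Measure (ℕ → ℝ)}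
    (h : ∀ m : ℕ, μ.map (fun y : ℕ → ℝ => fun i : Fin m => y i)
      = Measure.pi fun _ : Fin m => γ) :
    μ = Measure.infinitePi fun _ : ℕ => γ := by
  refine Measure.eq_infinitePi _ fun s t ht => ?_
  set t' : ℕ → Set ℝ := fun k => if k ∈ s then t k else Set.univ with ht'
  have hmt' : ∀ k, MeasurableSet (t' k) := fun k => by
    simp only [ht']; split_ifs
    exacts [ht k, MeasurableSet.univ]
  obtain ⟨m, hm⟩ := s.exists_nat_subset_range
  have hpre : (fun y : ℕ → ℝ => fun i : Fin m => y i) ⁻¹'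
      (Set.univ.pi fun i : Fin m => t' i) = Set.pi s t := by
    ext y
    simp only [Set.mem_preimage, Set.mem_pi, Set.mem_univ, true_imp_iff, ht', Finset.mem_coe]
    constructor
    · intro H k hk
      simpa [hk] using H ⟨k, Finset.mem_range.1 (hm hk)⟩
    · intro H k
      split_ifs with hk
      exacts [H k hk, trivial]
  have hmap := Measure.map_apply (μ := μ) (f := fun y : ℕ → ℝ => fun i : Fin m => y i)
    (by fun_prop) (MeasurableSet.univ_pi fun i : Fin m => hmt' i)
  rw [← hpre, ← hmap, h, Measure.pi_pi, Fin.prod_univ_eq_prod_range (fun k => γ (t' k)) m]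
  have : ∏ k ∈ s, γ (t k) = ∏ k ∈ s, γ (t' k) :=
    Finset.prod_congr rfl fun k hk => by simp [ht', hk]
  rw [this]
  exact (Finset.prod_subset hm fun k _ hk => by simp [ht', hk]).symm

lemma map_fin_infinitePi (γ : Measure ℝ) [IsProbabilityMeasure γ] (m : ℕ) :
    (Measure.infinitePi fun _ : ℕ => γ).map (fun y : ℕ → ℝ => fun i : Fin m => y i)
      = Measure.pi fun _ : Fin m => γ := by
  refine (Measure.pi_eq fun t ht => ?_).symm
  set t' : ℕ → Set ℝ := fun k => if hk : k < m then t ⟨k, hk⟩ else Set.univ with ht'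
  have hpre : (fun y : ℕ → ℝ => fun i : Fin m => y i) ⁻¹' Set.univ.pi t
      = Set.pi (Finset.range m) t' := by
    ext y
    simp only [Set.mem_preimage, Set.mem_pi, Set.mem_univ, true_imp_iff, ht', Finset.mem_coe,
      Finset.mem_range]
    exact ⟨fun H k hk => by simpa [hk] using H ⟨k, hk⟩, fun H k => by simpa using H k k.2⟩
  rw [Measure.map_apply (by fun_prop) (MeasurableSet.univ_pi ht), hpre, Measure.infinitePi_pi,
    ← Fin.prod_univ_eq_prod_range (fun k => γ (t' k)) m]
  · simp [ht']
  · intro k hk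
    simp [ht', Finset.mem_range.1 hk, ht]

/-- Size bound for one elementary step of the splitting scheme. -/
noncomputable def shellBound (κ : ℕ → ℝ) (e : ℕ) (x : ℕ → ℝ) : ℝ :=
  2 * |κ (e / 2)| * (|x (e / 2)| + |x (e / 2 + 1)| + |x (e / 2 + 2)|) ^ 2

/-- Angular velocity of the elementary rotation number `e`. -/
noncomputable def shellRate (κ : ℕ → ℝ) (e : ℕ) (x : ℕ → ℝ) : ℝ :=
  (-1) ^ e * κ (e / 2) * (√2 / 2 * (x (e / 2 + 2) - (-1) ^ e * x (e / 2)))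

/-- The coordinate rotated against `x (e / 2 + 1)` by the elementary rotation number `e`. -/
noncomputable def shellAxis (e : ℕ) (x : ℕ → ℝ) : ℝ :=
  √2 / 2 * (x (e / 2) + (-1) ^ e * x (e / 2 + 2))

/-- `(cos (h * ω) - 1) / h`, extended continuously to `h = 0`. -/
noncomputable def cosQuot (h ω : ℝ) : ℝ := -(h * ω ^ 2 / 2) * Real.sinc (h * ω / 2) ^ 2

/-- `sin (h * ω) / h`, extended continuously to `h = 0`. -/
noncomputable def sinQuot (h ω : ℝ) : ℝ := ω * Real.sinc (h * ω)

/-- Difference quotient over a time step `h` of the elementary rotation number `e`. The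
interaction of the coordinates `m, m + 1, m + 2` is split into the rotations number `2 * m` and
`2 * m + 1`. -/
noncomputable def shellIncr (κ : ℕ → ℝ) (e : ℕ) (h : ℝ) (x : ℕ → ℝ) (i : ℕ) : ℝ :=
  let c := cosQuot h (shellRate κ e x)
  let s := sinQuot h (shellRate κ e x)
  let p := shellAxis e x
  let b := x (e / 2 + 1)
  if i = e / 2 then √2 / 2 * (p * c + b * s)
  else if i = e / 2 + 1 then b * c - p * s
  else if i = e / 2 + 2 then (-1) ^ e * (√2 / 2 * (p * c + b * s))
  else 0

/-- The elementary rotation number `e` over a time step `h`. -/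
noncomputable def shellStep (κ : ℕ → ℝ) (e : ℕ) (h : ℝ) (x : ℕ → ℝ) (i : ℕ) : ℝ :=
  x i + h * shellIncr κ e h x i

lemma mul_sinc (x : ℝ) : x * Real.sinc x = Real.sin x := by
  rcases eq_or_ne x 0 with rfl | hx
  · simp
  · rw [Real.sinc_of_ne_zero hx]; field_simp

lemma mul_sinQuot (h ω : ℝ) : h * sinQuot h ω = Real.sin (h * ω) := by
  rw [sinQuot, ← mul_sinc]; ring

lemma mul_cosQuot (h ω : ℝ) : h * cosQuot h ω = Real.cos (h * ω) - 1 := by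
  have h1 : Real.cos (h * ω) = 1 - 2 * Real.sin (h * ω / 2) ^ 2 := by
    have := Real.cos_sq_add_sin_sq (h * ω / 2)
    rw [show h * ω = 2 * (h * ω / 2) by ring, Real.cos_two_mul,
      show 2 * (h * ω / 2) / 2 = h * ω / 2 by ring]
    linarith
  rw [h1, ← mul_sinc, cosQuot]; ring

lemma abs_sinQuot_le (h ω : ℝ) : |sinQuot h ω| ≤ |ω| := by
  rw [sinQuot, abs_mul]
  exact mul_le_of_le_one_right (abs_nonneg _) (Real.abs_sinc_le_one _)

lemma abs_cosQuot_le (h ω : ℝ) : |cosQuot h ω| ≤ |ω| := by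
  have : cosQuot h ω = -ω * (Real.sin (h * ω / 2) * Real.sinc (h * ω / 2)) := by
    rw [cosQuot, ← mul_sinc]; ring
  rw [this, abs_mul, abs_neg, abs_mul]
  exact mul_le_of_le_one_right (abs_nonneg _) (mul_le_one₀ (Real.abs_sin_le_one _) (abs_nonneg _)
    (Real.abs_sinc_le_one _))

lemma shellBound_nonneg (κ : ℕ → ℝ) (e : ℕ) (x : ℕ → ℝ) : 0 ≤ shellBound κ e x := by
  unfold shellBound; positivity

lemma abs_shellIncr_le (κ : ℕ → ℝ) (e : ℕ) (h : ℝ) (x : ℕ → ℝ) (i : ℕ) :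
    |shellIncr κ e h x i| ≤ shellBound κ e x := by
  set S := |x (e / 2)| + |x (e / 2 + 1)| + |x (e / 2 + 2)| with hS
  have hsg : |(-1 : ℝ) ^ e| = 1 := by simp
  have hq : |√2 / 2| ≤ 1 := by
    rw [abs_of_nonneg (by positivity)]
    nlinarith [Real.sq_sqrt (show (0 : ℝ) ≤ 2 by norm_num), Real.sqrt_nonneg 2]
  have ha := abs_nonneg (x (e / 2))
  have hb := abs_nonneg (x (e / 2 + 1))
  have hc := abs_nonneg (x (e / 2 + 2))
  have hS0 : 0 ≤ S := by positivity
  have hp : |shellAxis e x| ≤ S := by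
    rw [shellAxis, abs_mul]
    refine (mul_le_of_le_one_left (abs_nonneg _) hq).trans ((abs_add_le _ _).trans ?_)
    rw [abs_mul, hsg]; linarith
  have hr : |shellRate κ e x| ≤ |κ (e / 2)| * S := by
    rw [shellRate, abs_mul, abs_mul, hsg, one_mul, abs_mul]
    refine mul_le_mul_of_nonneg_left ?_ (abs_nonneg _)
    refine (mul_le_of_le_one_left (abs_nonneg _) hq).trans ((abs_sub _ _).trans ?_)
    rw [abs_mul, hsg]; linarith
  have hprod : ∀ u v : ℝ, |u| ≤ S → |v| ≤ |shellRate κ e x| → |u * v| ≤ |κ (e / 2)| * S ^ 2 := by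
    intro u v hu hv
    rw [abs_mul]
    calc |u| * |v| ≤ S * (|κ (e / 2)| * S) :=
          mul_le_mul hu (hv.trans hr) (abs_nonneg _) hS0
      _ = _ := by ring
  have hbS : |x (e / 2 + 1)| ≤ S := by linarith
  have h1 := hprod _ _ hp (abs_cosQuot_le h _)
  have h2 := hprod _ _ hbS (abs_sinQuot_le h _)
  have h3 := hprod _ _ hbS (abs_cosQuot_le h _)
  have h4 := hprod _ _ hp (abs_sinQuot_le h _)
  have hbound : shellBound κ e x = |κ (e / 2)| * S ^ 2 + |κ (e / 2)| * S ^ 2 := by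
    rw [shellBound, ← hS]; ring
  have h5 : |√2 / 2 * (shellAxis e x * cosQuot h (shellRate κ e x) +
      x (e / 2 + 1) * sinQuot h (shellRate κ e x))| ≤ shellBound κ e x := by
    rw [abs_mul, hbound]
    exact (mul_le_of_le_one_left (abs_nonneg _) hq).trans
      ((abs_add_le _ _).trans (add_le_add h1 h2))
  unfold shellIncr
  dsimp only
  split_ifs
  · exact h5
  · rw [hbound]
    exact (abs_sub _ _).trans (add_le_add h3 h4)
  · rw [abs_mul, hsg, one_mul]; exact h5
  · simpa using shellBound_nonneg κ e x

lemma continuous_shellIncr (κ : ℕ → ℝ) (e i : ℕ) :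
    Continuous fun q : ℝ × (ℕ → ℝ) => shellIncr κ e q.1 q.2 i := by
  have hsinc := Real.continuous_sinc
  have hr : Continuous fun q : ℝ × (ℕ → ℝ) => shellRate κ e q.2 := by
    unfold shellRate; fun_prop
  have hp : Continuous fun q : ℝ × (ℕ → ℝ) => shellAxis e q.2 := by
    unfold shellAxis; fun_prop
  unfold shellIncr cosQuot sinQuot
  dsimp only
  split_ifs <;> fun_prop

lemma shellIncr_eq_zero {κ : ℕ → ℝ} {e i : ℕ} (hi : 2 * i + 2 ≤ e) (h : ℝ) (x : ℕ → ℝ) :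
    shellIncr κ e h x i = 0 := by
  unfold shellIncr
  dsimp only
  rw [if_neg (by omega), if_neg (by omega), if_neg (by omega)]

lemma measurable_shellStep (κ : ℕ → ℝ) (e : ℕ) (h : ℝ) : Measurable (shellStep κ e h) := by
  refine measurable_pi_iff.2 fun i => ?_
  have := (continuous_shellIncr κ e i).comp (Continuous.prodMk_right h)
  exact ((continuous_apply i).add (continuous_const.mul this)).measurable

lemma shellStep_eq_planeRot (κ : ℕ → ℝ) (e : ℕ) (h : ℝ) :
    shellStep κ e h = planeRot (e / 2) (e / 2 + 2) (fun _ => -((-1) ^ e * (Real.pi / 4))) ∘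
      planeRot (e / 2) (e / 2 + 1) (fun x => h * ((-1) ^ e * κ (e / 2) * x (e / 2 + 2))) ∘
      planeRot (e / 2) (e / 2 + 2) (fun _ => (-1) ^ e * (Real.pi / 4)) := by
  have hsin : Real.sin ((-1) ^ e * (Real.pi / 4)) = (-1) ^ e * (√2 / 2) := by
    rcases neg_one_pow_eq_or ℝ e with he | he <;> simp [he]
  have hcos : Real.cos ((-1) ^ e * (Real.pi / 4)) = √2 / 2 := by
    rcases neg_one_pow_eq_or ℝ e with he | he <;> simp [he]
  have hsg : ((-1 : ℝ) ^ e) ^ 2 = 1 := by rw [← pow_mul, mul_comm, pow_mul]; simp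
  have h2 : √2 ^ 2 = (2 : ℝ) := Real.sq_sqrt (by norm_num)
  ext x i
  have hS := mul_sinQuot h (shellRate κ e x)
  have hC := mul_cosQuot h (shellRate κ e x)
  have hrate : h * ((-1) ^ e * κ (e / 2) *
      (-((-1) ^ e * (√2 / 2) * x (e / 2)) + √2 / 2 * x (e / 2 + 2))) =
      h * shellRate κ e x := by unfold shellRate; ring
  have hcos' : Real.cos (h * shellRate κ e x) = 1 + h * cosQuot h (shellRate κ e x) := by
    rw [hC]; ring
  simp only [shellStep, shellIncr, planeRot, Function.comp, Real.sin_neg, Real.cos_neg, hsin, hcos]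
  by_cases h0 : i = e / 2
  · subst h0
    simp
    rw [hrate, hcos', ← hS]
    simp only [shellAxis]
    linear_combination (-(x (e / 2)) / 4) * (1 + ((-1) ^ e) ^ 2) * h2 - x (e / 2) / 2 * hsg
  by_cases h1 : i = e / 2 + 1
  · subst h1
    simp
    rw [hrate, hcos', ← hS]
    simp only [shellAxis]
    ring
  by_cases h3 : i = e / 2 + 2
  · subst h3
    simp
    rw [hrate, hcos', ← hS]
    simp only [shellAxis]
    linear_combination (-(x (e / 2 + 2)) / 4) * (1 + ((-1) ^ e) ^ 2) * h2
      - x (e / 2 + 2) / 2 * hsg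
  simp [h0, h1, h3]

lemma measurePreserving_shellStep (γ : Measure ℝ) [IsGaussian γ] (hγ : ∫ x, x ∂γ = 0)
    (κ : ℕ → ℝ) (e : ℕ) (h : ℝ) :
    MeasurePreserving (shellStep κ e h) (Measure.infinitePi fun _ : ℕ => γ)
      (Measure.infinitePi fun _ : ℕ => γ) := by
  rw [shellStep_eq_planeRot]
  refine (measurePreserving_planeRot γ hγ (by simp) (by fun_prop) (by simp)).comp
    ((measurePreserving_planeRot γ hγ (by simp) (by fun_prop) (by simp)).comp
      (measurePreserving_planeRot γ hγ (by simp) (by fun_prop) (by simp)))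

lemma sum_range_two_mul (f : ℕ → ℝ) (n : ℕ) :
    ∑ e ∈ Finset.range (2 * n), f e = ∑ m ∈ Finset.range n, (f (2 * m) + f (2 * m + 1)) := by
  induction n with
  | zero => simp
  | succ n ih =>
    rw [mul_add, mul_one, Finset.sum_range_succ, Finset.sum_range_succ, ih,
      Finset.sum_range_succ, add_assoc]

/-- The drift of coordinate `i`: the sum of all elementary generators acting on it. -/
noncomputable def shellDrift (κ : ℕ → ℝ) (x : ℕ → ℝ) (i : ℕ) : ℝ :=
  ∑ e ∈ Finset.range (2 * (i + 1)), shellIncr κ e 0 x i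

lemma shellIncr_zero_add (κ : ℕ → ℝ) (m : ℕ) (x : ℕ → ℝ) (i : ℕ) :
    shellIncr κ (2 * m) 0 x i + shellIncr κ (2 * m + 1) 0 x i =
      if i = m then -κ m * x m * x (m + 1)
      else if i = m + 1 then κ m * (x m ^ 2 - x (m + 2) ^ 2)
      else if i = m + 2 then κ m * x (m + 1) * x (m + 2) else 0 := by
  have h2 : √2 ^ 2 = (2 : ℝ) := Real.sq_sqrt (by norm_num)
  have e1 : (2 * m + 1) / 2 = m := by omega
  have e2 : 2 * m / 2 = m := by omega
  simp only [shellIncr, shellAxis, shellRate, cosQuot, sinQuot, e1, e2, pow_succ, pow_mul]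
  norm_num
  split_ifs
  · linear_combination (-κ m * x m * x (m + 1)) / 2 * h2
  · linear_combination (κ m * (x m ^ 2 - x (m + 2) ^ 2)) / 2 * h2
  · linear_combination (κ m * x (m + 1) * x (m + 2)) / 2 * h2
  · simp

lemma shellDrift_zero (κ : ℕ → ℝ) (x : ℕ → ℝ) : shellDrift κ x 0 = -κ 0 * x 0 * x 1 := by
  rw [shellDrift, sum_range_two_mul]
  simp [shellIncr_zero_add]

lemma shellDrift_one (κ : ℕ → ℝ) (x : ℕ → ℝ) :
    shellDrift κ x 1 = κ 0 * (x 0 ^ 2 - x 2 ^ 2) - κ 1 * x 1 * x 2 := by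
  rw [shellDrift, sum_range_two_mul]
  simp [shellIncr_zero_add, Finset.sum_range_succ]
  ring

lemma shellDrift_add_two (κ : ℕ → ℝ) (x : ℕ → ℝ) (j : ℕ) :
    shellDrift κ x (j + 2) = κ (j + 1) * (x (j + 1) ^ 2 - x (j + 3) ^ 2)
      - κ (j + 2) * x (j + 2) * x (j + 3) + κ j * x (j + 1) * x (j + 2) := by
  rw [shellDrift, sum_range_two_mul, Finset.sum_range_succ, Finset.sum_range_succ,
    Finset.sum_range_succ, Finset.sum_eq_zero]
  · simp [shellIncr_zero_add]
    ring
  · intro m hm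
    rw [Finset.mem_range] at hm
    rw [shellIncr_zero_add, if_neg (by omega), if_neg (by omega), if_neg (by omega)]

lemma isCwShellSolution_of_shellDrift {lam T : ℝ} {y : ℕ → ℝ} {Y : ℕ → ℝ → ℝ}
    (hc : ∀ i, ContinuousOn (Y i) (Set.Icc 0 T))
    (hY : ∀ i, ∀ t ∈ Set.Icc (0 : ℝ) T, Y i t = y i +
      ∫ s in (0 : ℝ)..t, shellDrift (fun m => lam ^ (m + 2)) (fun l => Y l s) i) :
    IsCwShellSolution lam T (fun n => y (n - 1))
      (fun n t => if n = 0 then 0 else Y (n - 1) t) := by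
  refine ⟨by simp, fun n hn => ?_⟩
  obtain ⟨i, rfl⟩ : ∃ i, n = i + 1 := ⟨n - 1, by omega⟩
  refine ⟨by simpa using hc i, fun t ht => ?_⟩
  simp only [Nat.add_eq_zero_iff, one_ne_zero, and_false, if_false, Nat.add_sub_cancel]
  rw [hY i t ht]
  congr 2
  ext s
  rcases i with _ | _ | j
  · simp [shellDrift_zero, mixedK]
  · simp [shellDrift_one, mixedK]
    ring
  · simp [shellDrift_add_two, mixedK]
    ring

open Filter Topology in
lemma exists_subseq_tendsto_of_modulus {T : ℝ} (hT : 0 ≤ T) {X : ℕ → ℕ → ℝ → ℝ} {y c : ℕ → ℝ}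
    (h0 : ∀ N i, X N i 0 = y i)
    (hX : ∀ N i s t, 0 ≤ s → s ≤ t → t ≤ T → |X N i t - X N i s| ≤ c i * √(t - s)) :
    ∃ φ : ℕ → ℕ, StrictMono φ ∧ ∃ Y : ℕ → ℝ → ℝ,
      (∀ i, ContinuousOn (Y i) (Set.Icc 0 T)) ∧
      ∀ i, ∀ t ∈ Set.Icc (0 : ℝ) T, Tendsto (fun k => X (φ k) i t) atTop (𝓝 (Y i t)) := by
  have hXd : ∀ N i (s t : Set.Icc (0 : ℝ) T), dist (X N i s) (X N i t) ≤ c i * √(dist s t) := by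
    intro N i s t
    rw [Real.dist_eq, Subtype.dist_eq, Real.dist_eq]
    rcases le_total (s : ℝ) t with h | h
    · rw [abs_sub_comm, abs_sub_comm (s : ℝ), abs_of_nonneg (sub_nonneg.2 h)]
      exact hX N i s t s.2.1 h t.2.2
    · rw [abs_of_nonneg (sub_nonneg.2 h)]
      exact hX N i t s t.2.1 h s.2.2
  have hlim : ∀ i, Tendsto (fun r : ℝ => c i * √r) (𝓝 0) (𝓝 0) := fun i => by
    have : Continuous fun r : ℝ => c i * √r := by fun_prop
    simpa using this.tendsto 0
  let o : Set.Icc (0 : ℝ) T := ⟨0, le_rfl, hT⟩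
  let S : ℕ → Set C(Set.Icc (0 : ℝ) T, ℝ) := fun i =>
    {f | f o = y i ∧ ∀ s t, dist (f s) (f t) ≤ c i * √(dist s t)}
  have hequi : ∀ i, Equicontinuous ((↑) : S i → Set.Icc (0 : ℝ) T → ℝ) := fun i =>
    Metric.equicontinuous_of_continuity_modulus _ (hlim i) _ fun s t f => f.2.2 s t
  have hScomp : ∀ i, IsCompact (S i) := by
    intro i
    refine ArzelaAscoli.isCompact_of_equicontinuous _ ?_ (hequi i)
    have himg : ContinuousMap.toFun '' S i =
        {f | f o = y i ∧ ∀ s t, dist (f s) (f t) ≤ c i * √(dist s t)} := by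
      ext f
      constructor
      · rintro ⟨g, hg, rfl⟩
        exact hg
      · intro hf
        have hcont : Continuous f := (Metric.equicontinuous_of_continuity_modulus _ (hlim i)
          (fun _ : Unit => f) fun s t _ => hf.2 s t).continuous ()
        exact ⟨⟨f, hcont⟩, hf, rfl⟩
    rw [himg]
    refine (isCompact_univ_pi fun s : Set.Icc (0 : ℝ) T =>
      isCompact_closedBall (y i) (c i * √(dist s o))).of_isClosed_subset ?_ ?_
    · refine (isClosed_eq (by fun_prop) (by fun_prop)).and ?_
      simp only [Set.ofPred_forall]
      exact isClosed_iInter fun s => isClosed_iInter fun t =>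
        isClosed_le (by fun_prop) (by fun_prop)
    · rintro f hf s -
      rw [Metric.mem_closedBall, ← hf.1]
      exact hf.2 s o
  let F : ℕ → ∀ _ : ℕ, C(Set.Icc (0 : ℝ) T, ℝ) := fun N i =>
    ⟨fun t => X N i t, (Metric.equicontinuous_of_continuity_modulus _ (hlim i)
      (fun (_ : Unit) (t : Set.Icc (0 : ℝ) T) => X N i t) fun s t _ => hXd N i s t).continuous ()⟩
  obtain ⟨G, -, φ, hφ, hG⟩ := (isCompact_univ_pi hScomp).tendsto_subseq (x := F)
    fun N i _ => ⟨h0 N i, hXd N i⟩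
  refine ⟨φ, hφ, fun i => Set.IccExtend hT (G i), fun i => ?_, fun i t ht => ?_⟩
  · exact ((G i).continuous.Icc_extend' (h := hT)).continuousOn
  · change Tendsto _ _ (𝓝 (Set.IccExtend hT (G i) t))
    rw [Set.IccExtend_of_mem hT _ ht]
    have h1 : Tendsto (fun k => F (φ k) i) atTop (𝓝 (G i)) := (tendsto_pi_nhds.1 hG) i
    exact ((ContinuousEvalConst.continuous_eval_const (⟨t, ht⟩ : Set.Icc (0 : ℝ) T)).tendsto
      (G i)).comp h1

lemma integral_le_of_lintegral_sq_le {f : ℝ → ℝ} (hf : Measurable f) {T C : ℝ} (hC : 0 ≤ C)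
    (h : ∫⁻ s in Set.Icc 0 T, ENNReal.ofReal (f s ^ 2) ≤ ENNReal.ofReal C) :
    IntegrableOn f (Set.Icc 0 T) ∧ ∀ s t, 0 ≤ s → s ≤ t → t ≤ T →
      ∫ r in s..t, f r ≤ (1 + C) / 2 * √(t - s) := by
  have hsq : IntegrableOn (fun s => f s ^ 2) (Set.Icc 0 T) := by
    refine ⟨(hf.pow_const 2).aestronglyMeasurable, ?_⟩
    rw [hasFiniteIntegral_iff_ofReal (Filter.Eventually.of_forall fun s => sq_nonneg _)]
    exact h.trans_lt ENNReal.ofReal_lt_top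
  have hint : IntegrableOn f (Set.Icc 0 T) := by
    refine Integrable.mono' ((integrable_const (1 : ℝ)).add hsq) hf.aestronglyMeasurable
      (Filter.Eventually.of_forall fun s => ?_)
    simp only [Pi.add_apply, Real.norm_eq_abs]
    nlinarith [sq_abs (f s), sq_nonneg (|f s| - 1)]
  refine ⟨hint, fun s t hs hst ht => ?_⟩
  have hsub : Set.Ioc s t ⊆ Set.Icc 0 T := fun r hr => ⟨hs.trans hr.1.le, hr.2.trans ht⟩
  have hsqle : ∫ r in s..t, f r ^ 2 ≤ C := by
    rw [intervalIntegral.integral_of_le hst,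
      integral_eq_lintegral_of_nonneg_ae (Filter.Eventually.of_forall fun s => sq_nonneg _)
        (hf.pow_const 2).aestronglyMeasurable]
    refine ENNReal.toReal_le_of_le_ofReal hC (le_trans ?_ h)
    exact lintegral_mono_set hsub
  rcases hst.eq_or_lt with rfl | hlt
  · simp
  set d := √(t - s) with hd
  have hdpos : 0 < d := Real.sqrt_pos.2 (sub_pos.2 hlt)
  have hd2 : d ^ 2 = t - s := Real.sq_sqrt (sub_pos.2 hlt).le
  have hI1 : IntervalIntegrable f volume s t :=
    (intervalIntegrable_iff_integrableOn_Ioc_of_le hst).2 (hint.mono_set hsub)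
  have hI2 : IntervalIntegrable (fun r => f r ^ 2) volume s t :=
    (intervalIntegrable_iff_integrableOn_Ioc_of_le hst).2 (hsq.mono_set hsub)
  calc ∫ r in s..t, f r ≤ ∫ r in s..t, (d⁻¹ / 2 + d / 2 * f r ^ 2) := by
        refine intervalIntegral.integral_mono_on hst hI1
          (intervalIntegrable_const.add (hI2.const_mul _)) fun r _ => ?_
        have : d⁻¹ / 2 + d / 2 * f r ^ 2 - f r = d / 2 * (f r - d⁻¹) ^ 2 := by
          field_simp; ring
        have h2 : 0 ≤ d / 2 * (f r - d⁻¹) ^ 2 := by positivity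
        linarith
    _ = (t - s) * (d⁻¹ / 2) + d / 2 * ∫ r in s..t, f r ^ 2 := by
        rw [intervalIntegral.integral_add intervalIntegrable_const (hI2.const_mul _),
          intervalIntegral.integral_const, intervalIntegral.integral_const_mul, smul_eq_mul]
    _ ≤ (t - s) * (d⁻¹ / 2) + d / 2 * C := by gcongr
    _ = (1 + C) / 2 * d := by rw [← hd2]; field_simp

/-- The state after the first `e` elementary rotations of one cycle of the splitting scheme. -/
noncomputable def shellSweep (κ : ℕ → ℝ) (h : ℝ) : ℕ → (ℕ → ℝ) → ℕ → ℝ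
  | 0, x => x
  | e + 1, x => shellStep κ e h (shellSweep κ h e x)

/-- The state after a full cycle. Coordinate `i` only changes in the first `2 * (i + 1)`
elementary rotations. -/
noncomputable def shellCycle (κ : ℕ → ℝ) (h : ℝ) (x : ℕ → ℝ) (i : ℕ) : ℝ :=
  shellSweep κ h (2 * (i + 1)) x i

/-- The state after `e` elementary rotations of the cycle that is running at time `s`. -/
noncomputable def shellPath (κ : ℕ → ℝ) (h : ℝ) (y : ℕ → ℝ) (e : ℕ) (s : ℝ) : ℕ → ℝ :=
  shellSweep κ h e ((shellCycle κ h)^[⌊s / h⌋₊] y)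

/-- The velocity of coordinate `i` in the interpolated splitting scheme. -/
noncomputable def shellSpeed (κ : ℕ → ℝ) (h : ℝ) (y : ℕ → ℝ) (i : ℕ) (s : ℝ) : ℝ :=
  ∑ e ∈ Finset.range (2 * (i + 1)), shellIncr κ e h (shellPath κ h y e s) i

/-- The piecewise linear interpolation of the splitting scheme. -/
noncomputable def shellInterp (κ : ℕ → ℝ) (h : ℝ) (y : ℕ → ℝ) (i : ℕ) (t : ℝ) : ℝ :=
  y i + ∫ s in (0 : ℝ)..t, shellSpeed κ h y i s

lemma shellSweep_apply (κ : ℕ → ℝ) (h : ℝ) (e : ℕ) (x : ℕ → ℝ) (i : ℕ) :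
    shellSweep κ h e x i =
      x i + h * ∑ n ∈ Finset.range e, shellIncr κ n h (shellSweep κ h n x) i := by
  induction e with
  | zero => simp [shellSweep]
  | succ e ih => rw [shellSweep, shellStep, Finset.sum_range_succ, ih]; ring

lemma shellSweep_eq_shellCycle (κ : ℕ → ℝ) (h : ℝ) {e i : ℕ} (hi : 2 * (i + 1) ≤ e) (x : ℕ → ℝ) :
    shellSweep κ h e x i = shellCycle κ h x i := by
  induction e, hi using Nat.le_induction with
  | base => rfl
  | succ e he ih => rw [shellSweep, shellStep, shellIncr_eq_zero (by omega), ih]; simp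

lemma measurePreserving_shellSweep (γ : Measure ℝ) [IsGaussian γ] (hγ : ∫ x, x ∂γ = 0)
    (κ : ℕ → ℝ) (h : ℝ) (e : ℕ) :
    MeasurePreserving (shellSweep κ h e) (Measure.infinitePi fun _ : ℕ => γ)
      (Measure.infinitePi fun _ : ℕ => γ) := by
  induction e with
  | zero => exact MeasurePreserving.id _
  | succ e ih => exact (measurePreserving_shellStep γ hγ κ e h).comp ih

lemma measurable_shellSweep (κ : ℕ → ℝ) (h : ℝ) (e : ℕ) : Measurable (shellSweep κ h e) := by
  induction e with
  | zero => exact measurable_id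
  | succ e ih => exact (measurable_shellStep κ e h).comp ih

lemma measurable_shellCycle (κ : ℕ → ℝ) (h : ℝ) : Measurable (shellCycle κ h) :=
  measurable_pi_iff.2 fun i => (measurable_pi_apply i).comp (measurable_shellSweep κ h _)

lemma measurePreserving_shellCycle (γ : Measure ℝ) [IsGaussian γ] (hγ : ∫ x, x ∂γ = 0)
    (κ : ℕ → ℝ) (h : ℝ) :
    MeasurePreserving (shellCycle κ h) (Measure.infinitePi fun _ : ℕ => γ)
      (Measure.infinitePi fun _ : ℕ => γ) := by
  refine ⟨measurable_shellCycle κ h, eq_infinitePi_of_map_fin fun m => ?_⟩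
  have hcomp : (fun y : ℕ → ℝ => fun i : Fin m => y i) ∘ shellCycle κ h =
      (fun y : ℕ → ℝ => fun i : Fin m => y i) ∘ shellSweep κ h (2 * m) := by
    ext x i
    exact (shellSweep_eq_shellCycle κ h (by have := i.2; omega) x).symm
  rw [Measure.map_map (by fun_prop) (measurable_shellCycle κ h), hcomp,
    ← Measure.map_map (by fun_prop) (measurable_shellSweep κ h _),
    (measurePreserving_shellSweep γ hγ κ h _).map_eq, map_fin_infinitePi]

lemma abs_shellSweep_sub_le (κ : ℕ → ℝ) {h : ℝ} (hh : 0 ≤ h) (e : ℕ) (x : ℕ → ℝ) (i : ℕ) :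
    |shellSweep κ h e x i - x i| ≤
      h * ∑ n ∈ Finset.range (2 * (i + 1)), shellBound κ n (shellSweep κ h n x) := by
  have hsub : ∑ n ∈ Finset.range e, shellIncr κ n h (shellSweep κ h n x) i =
      ∑ n ∈ Finset.range e with n < 2 * (i + 1), shellIncr κ n h (shellSweep κ h n x) i := by
    rw [Finset.sum_filter]
    refine Finset.sum_congr rfl fun n _ => ?_
    split_ifs with hn
    · rfl
    · exact shellIncr_eq_zero (by omega) _ _
  rw [shellSweep_apply, add_sub_cancel_left, abs_mul, abs_of_nonneg hh, hsub]
  refine mul_le_mul_of_nonneg_left ((Finset.abs_sum_le_sum_abs _ _).trans ?_) hh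
  refine (Finset.sum_le_sum fun n _ => abs_shellIncr_le κ n h _ i).trans ?_
  refine Finset.sum_le_sum_of_subset_of_nonneg (fun n hn => ?_) fun n _ _ => shellBound_nonneg _ _ _
  simpa using (Finset.mem_filter.1 hn).2

lemma continuous_shellBound (κ : ℕ → ℝ) (e : ℕ) : Continuous (shellBound κ e) := by
  unfold shellBound; fun_prop

lemma measurable_shellPath (κ : ℕ → ℝ) (h : ℝ) (e : ℕ) :
    Measurable fun p : ℝ × (ℕ → ℝ) => shellPath κ h p.2 e p.1 := by
  have h1 : Measurable fun q : ℕ × (ℕ → ℝ) => shellSweep κ h e ((shellCycle κ h)^[q.1] q.2) :=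
    measurable_from_prod_countable_right fun n =>
      (measurable_shellSweep κ h e).comp ((measurable_shellCycle κ h).iterate n)
  have h2 : Measurable fun p : ℝ × (ℕ → ℝ) => (⌊p.1 / h⌋₊, p.2) :=
    (Nat.measurable_floor.comp (measurable_fst.div_const h)).prodMk measurable_snd
  exact h1.comp h2

lemma measurable_shellPath_left (κ : ℕ → ℝ) (h : ℝ) (y : ℕ → ℝ) (e : ℕ) :
    Measurable (shellPath κ h y e) :=
  (measurable_shellPath κ h e).comp (measurable_id.prodMk measurable_const)

lemma measurable_shellSpeed (κ : ℕ → ℝ) (h : ℝ) (y : ℕ → ℝ) (i : ℕ) :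
    Measurable (shellSpeed κ h y i) := by
  unfold shellSpeed
  refine Finset.measurable_sum _ fun e _ => ?_
  exact ((continuous_shellIncr κ e i).comp (Continuous.prodMk_right h)).measurable.comp
    (measurable_shellPath_left κ h y e)

lemma abs_shellSpeed_le (κ : ℕ → ℝ) (h : ℝ) (y : ℕ → ℝ) (i : ℕ) (s : ℝ) :
    |shellSpeed κ h y i s| ≤
      ∑ e ∈ Finset.range (2 * (i + 1)), shellBound κ e (shellPath κ h y e s) :=
  (Finset.abs_sum_le_sum_abs _ _).trans
    (Finset.sum_le_sum fun e _ => abs_shellIncr_le κ e h _ i)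

lemma shellPath_eq_of_mem_Ioo (κ : ℕ → ℝ) {h : ℝ} (hh : 0 < h) (y : ℕ → ℝ) (e : ℕ) {j : ℕ} {s : ℝ}
    (hs : s ∈ Set.Ioo (j * h) ((j + 1) * h)) :
    shellPath κ h y e s = shellSweep κ h e ((shellCycle κ h)^[j] y) := by
  have : ⌊s / h⌋₊ = j := by
    rw [Nat.floor_eq_iff (div_nonneg ((by positivity : (0 : ℝ) ≤ j * h).trans hs.1.le) hh.le),
      le_div_iff₀ hh, div_lt_iff₀ hh]
    exact ⟨hs.1.le, hs.2⟩
  rw [shellPath, this]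

/-- The modulus constant of coordinate `i`, given `L²` bounds `C` on the elementary steps. -/
noncomputable def shellModulus (C : ℕ → ℝ) (i : ℕ) : ℝ :=
  ∑ e ∈ Finset.range (2 * (i + 1)), (1 + C e) / 2

lemma shellModulus_nonneg {C : ℕ → ℝ} (hC : ∀ e, 0 ≤ C e) (i : ℕ) : 0 ≤ shellModulus C i :=
  Finset.sum_nonneg fun e _ => by linarith [hC e]

section Bounds

variable {κ : ℕ → ℝ} {h : ℝ} {y : ℕ → ℝ} {T : ℝ} {C : ℕ → ℝ}

lemma integrableOn_shellBound (hC : ∀ e, 0 ≤ C e)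
    (hb : ∀ e, ∫⁻ s in Set.Icc 0 T, ENNReal.ofReal (shellBound κ e (shellPath κ h y e s) ^ 2)
      ≤ ENNReal.ofReal (C e)) (e : ℕ) {s t : ℝ} (hs : 0 ≤ s) (hst : s ≤ t) (ht : t ≤ T) :
    IntervalIntegrable (fun r => shellBound κ e (shellPath κ h y e r)) volume s t := by
  have := (integral_le_of_lintegral_sq_le ((continuous_shellBound κ e).measurable.comp
    (measurable_shellPath_left κ h y e)) (hC e) (hb e)).1
  exact (intervalIntegrable_iff_integrableOn_Ioc_of_le hst).2
    (this.mono_set fun r hr => ⟨hs.trans hr.1.le, hr.2.trans ht⟩)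

lemma integral_sum_shellBound_le (hC : ∀ e, 0 ≤ C e)
    (hb : ∀ e, ∫⁻ s in Set.Icc 0 T, ENNReal.ofReal (shellBound κ e (shellPath κ h y e s) ^ 2)
      ≤ ENNReal.ofReal (C e)) (i : ℕ) {s t : ℝ} (hs : 0 ≤ s) (hst : s ≤ t) (ht : t ≤ T) :
    ∫ r in s..t, ∑ e ∈ Finset.range (2 * (i + 1)), shellBound κ e (shellPath κ h y e r)
      ≤ shellModulus C i * √(t - s) := by
  rw [intervalIntegral.integral_finsetSum
    fun e _ => integrableOn_shellBound hC hb e hs hst ht, shellModulus, Finset.sum_mul]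
  exact Finset.sum_le_sum fun e _ => (integral_le_of_lintegral_sq_le
    ((continuous_shellBound κ e).measurable.comp (measurable_shellPath_left κ h y e))
    (hC e) (hb e)).2 s t hs hst ht

lemma intervalIntegrable_shellSpeed (hC : ∀ e, 0 ≤ C e)
    (hb : ∀ e, ∫⁻ s in Set.Icc 0 T, ENNReal.ofReal (shellBound κ e (shellPath κ h y e s) ^ 2)
      ≤ ENNReal.ofReal (C e)) (i : ℕ) {s t : ℝ} (hs : 0 ≤ s) (hst : s ≤ t) (ht : t ≤ T) :
    IntervalIntegrable (shellSpeed κ h y i) volume s t :=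
  (IntervalIntegrable.sum _ fun e _ => integrableOn_shellBound hC hb e hs hst ht).mono_fun'
    (measurable_shellSpeed κ h y i).aestronglyMeasurable
    (Filter.Eventually.of_forall fun r => by
      simpa only [Finset.sum_apply, Real.norm_eq_abs] using abs_shellSpeed_le κ h y i r)

lemma abs_shellInterp_sub_le (hC : ∀ e, 0 ≤ C e)
    (hb : ∀ e, ∫⁻ s in Set.Icc 0 T, ENNReal.ofReal (shellBound κ e (shellPath κ h y e s) ^ 2)
      ≤ ENNReal.ofReal (C e)) (i : ℕ) {s t : ℝ} (hs : 0 ≤ s) (hst : s ≤ t) (ht : t ≤ T) :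
    |shellInterp κ h y i t - shellInterp κ h y i s| ≤ shellModulus C i * √(t - s) := by
  rw [shellInterp, shellInterp, add_sub_add_left_eq_sub, intervalIntegral.integral_interval_sub_left
    (intervalIntegrable_shellSpeed hC hb i le_rfl (hs.trans hst) ht)
    (intervalIntegrable_shellSpeed hC hb i le_rfl hs (hst.trans ht))]
  refine le_trans ?_ (integral_sum_shellBound_le hC hb i hs hst ht)
  refine intervalIntegral.norm_integral_le_of_norm_le (f := shellSpeed κ h y i) hst
    (Filter.Eventually.of_forall fun r _ =>
      (Real.norm_eq_abs _).trans_le (abs_shellSpeed_le κ h y i r)) ?_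
  simpa only [Finset.sum_fn] using
    IntervalIntegrable.sum _ fun e _ => integrableOn_shellBound hC hb e hs hst ht

lemma shellInterp_mul (hh : 0 < h) (hC : ∀ e, 0 ≤ C e)
    (hb : ∀ e, ∫⁻ s in Set.Icc 0 T, ENNReal.ofReal (shellBound κ e (shellPath κ h y e s) ^ 2)
      ≤ ENNReal.ofReal (C e)) (i j : ℕ) (hj : j * h ≤ T) :
    shellInterp κ h y i (j * h) = (shellCycle κ h)^[j] y i := by
  induction j with
  | zero => simp [shellInterp]
  | succ j ih =>
    push_cast at hj ⊢
    have hle : (j : ℝ) * h ≤ (j + 1) * h := by nlinarith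
    have h0 : (0 : ℝ) ≤ j * h := by positivity
    have hint : ∫ s in (j * h)..((j + 1) * h), shellSpeed κ h y i s =
        h * ∑ e ∈ Finset.range (2 * (i + 1)),
          shellIncr κ e h (shellSweep κ h e ((shellCycle κ h)^[j] y)) i := by
      rw [intervalIntegral.integral_congr_Ioo_of_le hle (g := fun _ =>
        ∑ e ∈ Finset.range (2 * (i + 1)),
          shellIncr κ e h (shellSweep κ h e ((shellCycle κ h)^[j] y)) i) fun s hs => ?_]
      · rw [intervalIntegral.integral_const, smul_eq_mul]; ring
      · simp only [shellSpeed, shellPath_eq_of_mem_Ioo κ hh y _ hs]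
    have hadd := intervalIntegral.integral_add_adjacent_intervals
      (intervalIntegrable_shellSpeed hC hb i le_rfl h0 (hle.trans hj))
      (intervalIntegrable_shellSpeed hC hb i h0 hle hj)
    rw [shellInterp, ← hadd, hint, ← add_assoc, ← shellInterp, ih (hle.trans hj),
      Function.iterate_succ_apply', shellCycle, shellSweep_apply]

lemma abs_shellPath_sub_le (hh : 0 < h) (hC : ∀ e, 0 ≤ C e)
    (hb : ∀ e, ∫⁻ s in Set.Icc 0 T, ENNReal.ofReal (shellBound κ e (shellPath κ h y e s) ^ 2)
      ≤ ENNReal.ofReal (C e)) (e i : ℕ) {s : ℝ} (hs : 0 ≤ s) (hsT : s + h ≤ T) :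
    |shellPath κ h y e s i - shellInterp κ h y i s| ≤ 2 * (shellModulus C i * √h) := by
  set j := ⌊s / h⌋₊ with hj
  have hjs : j * h ≤ s := (le_div_iff₀ hh).1 (Nat.floor_le (div_nonneg hs hh.le))
  have hsj : s < (j + 1) * h := (div_lt_iff₀ hh).1 (Nat.lt_floor_add_one _)
  have h0 : (0 : ℝ) ≤ j * h := by positivity
  have hle : (j : ℝ) * h ≤ (j + 1) * h := by nlinarith
  have hjT : (j + 1) * h ≤ T := by linarith
  have h1 : |shellPath κ h y e s i - (shellCycle κ h)^[j] y i| ≤ shellModulus C i * √h := by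
    refine (abs_shellSweep_sub_le κ hh.le e _ i).trans ?_
    have := integral_sum_shellBound_le hC hb i h0 hle hjT
    rw [intervalIntegral.integral_congr_Ioo_of_le hle (g := fun _ =>
        ∑ n ∈ Finset.range (2 * (i + 1)),
          shellBound κ n (shellSweep κ h n ((shellCycle κ h)^[j] y))) fun r hr => by
        simp only [shellPath_eq_of_mem_Ioo κ hh y _ hr],
      intervalIntegral.integral_const, smul_eq_mul, show (j + 1) * h - j * h = h by ring] at this
    exact this
  have h2 : |shellInterp κ h y i s - (shellCycle κ h)^[j] y i| ≤ shellModulus C i * √h := by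
    rw [← shellInterp_mul hh hC hb i j (hle.trans hjT)]
    refine (abs_shellInterp_sub_le hC hb i h0 hjs (by linarith)).trans ?_
    exact mul_le_mul_of_nonneg_left (Real.sqrt_le_sqrt (by linarith)) (shellModulus_nonneg hC i)
  rw [abs_sub_comm] at h2
  linarith [abs_sub_le (shellPath κ h y e s i) ((shellCycle κ h)^[j] y i) (shellInterp κ h y i s)]

end Bounds

open Filter Topology in
lemma exists_shellDrift_solution {κ : ℕ → ℝ} {T : ℝ} (hT : 0 ≤ T) {y : ℕ → ℝ} {h : ℕ → ℝ}
    (hpos : ∀ N, 0 < h N) (hle : ∀ N, h N ≤ 1) (hlim : Tendsto h atTop (𝓝 0))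
    {C : ℕ → ℝ} (hC : ∀ e, 0 ≤ C e)
    (hb : ∀ N e, ∫⁻ s in Set.Icc 0 (T + 1),
      ENNReal.ofReal (shellBound κ e (shellPath κ (h N) y e s) ^ 2) ≤ ENNReal.ofReal (C e)) :
    ∃ Y : ℕ → ℝ → ℝ, (∀ i, ContinuousOn (Y i) (Set.Icc 0 T)) ∧
      ∀ i, ∀ t ∈ Set.Icc (0 : ℝ) T,
        Y i t = y i + ∫ s in (0 : ℝ)..t, shellDrift κ (fun l => Y l s) i := by
  obtain ⟨φ, hφ, Y, hYc, hY⟩ := exists_subseq_tendsto_of_modulus hT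
    (X := fun N => shellInterp κ (h N) y) (y := y) (c := shellModulus C)
    (fun N i => by simp [shellInterp])
    fun N i s t hs hst ht => abs_shellInterp_sub_le hC (hb N) i hs hst (by linarith)
  have hlim' : Tendsto (fun k => h (φ k)) atTop (𝓝 0) := hlim.comp hφ.tendsto_atTop
  have hclose : ∀ N e l, ∀ s ∈ Set.Icc 0 T, |shellPath κ (h N) y e s l -
      shellInterp κ (h N) y l s| ≤ 2 * (shellModulus C l * √(h N)) := fun N e l s hs =>
    abs_shellPath_sub_le (hpos N) hC (hb N) e l hs.1 (by linarith [hs.2, hle N])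
  have hpath : ∀ e l, ∀ s ∈ Set.Icc 0 T,
      Tendsto (fun k => shellPath κ (h (φ k)) y e s l) atTop (𝓝 (Y l s)) := by
    intro e l s hs
    refine (hY l s hs).congr_dist ?_
    have h0 : Tendsto (fun k => 2 * (shellModulus C l * √(h (φ k)))) atTop (𝓝 0) := by
      have : Continuous fun r : ℝ => 2 * (shellModulus C l * √r) := by fun_prop
      simpa [Function.comp_def] using (this.tendsto 0).comp hlim'
    refine squeeze_zero (fun k => dist_nonneg) (fun k => ?_) h0
    rw [dist_comm, Real.dist_eq]
    exact hclose (φ k) e l s hs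
  have hspeed : ∀ i, ∀ s ∈ Set.Icc 0 T, Tendsto (fun k => shellSpeed κ (h (φ k)) y i s) atTop
      (𝓝 (shellDrift κ (fun l => Y l s) i)) := by
    intro i s hs
    refine tendsto_finsetSum _ fun e _ => ?_
    have hpair : Tendsto (fun k => (h (φ k), shellPath κ (h (φ k)) y e s)) atTop
        (𝓝 ((0 : ℝ), fun l => Y l s)) :=
      hlim'.prodMk_nhds (tendsto_pi_nhds.2 fun l => hpath e l s hs)
    have hcomp := ((continuous_shellIncr κ e i).tendsto (0, fun l => Y l s)).comp hpair
    simpa only [Function.comp_def] using hcomp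
  set R : ℕ → ℝ := fun l => |y l| + shellModulus C l * √T + 2 * (shellModulus C l * √1) with hR
  have hR0 : ∀ l, 0 ≤ R l := fun l => by
    have := shellModulus_nonneg hC l
    positivity
  have hpathle : ∀ N e l, ∀ s ∈ Set.Icc 0 T, |shellPath κ (h N) y e s l| ≤ |R l| := by
    intro N e l s hs
    have hm := shellModulus_nonneg hC l
    have h1 := (hclose N e l s hs).trans (mul_le_mul_of_nonneg_left
      (mul_le_mul_of_nonneg_left (Real.sqrt_le_sqrt (hle N)) hm) zero_le_two)
    have h2 := (abs_shellInterp_sub_le hC (hb N) l le_rfl hs.1 (by linarith [hs.2])).trans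
      (mul_le_mul_of_nonneg_left (Real.sqrt_le_sqrt (by linarith [hs.2] : s - 0 ≤ T)) hm)
    have h3 : shellInterp κ (h N) y l 0 = y l := by simp [shellInterp]
    rw [h3] at h2
    rw [abs_of_nonneg (hR0 l)]
    have h4 := abs_sub_abs_le_abs_sub (shellPath κ (h N) y e s l) (shellInterp κ (h N) y l s)
    have h5 := abs_sub_abs_le_abs_sub (shellInterp κ (h N) y l s) (y l)
    simp only [hR]
    linarith
  have hspeedle : ∀ N i, ∀ s ∈ Set.Icc 0 T, |shellSpeed κ (h N) y i s| ≤
      ∑ e ∈ Finset.range (2 * (i + 1)), shellBound κ e R := by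
    intro N i s hs
    refine (abs_shellSpeed_le κ (h N) y i s).trans (Finset.sum_le_sum fun e _ => ?_)
    unfold shellBound
    have hcoord := fun l => (hpathle N e l s hs).trans_eq (abs_of_nonneg (hR0 l))
    simp only [abs_of_nonneg (hR0 _)]
    exact mul_le_mul_of_nonneg_left (pow_le_pow_left₀ (by positivity)
      (add_le_add (add_le_add (hcoord _) (hcoord _)) (hcoord _)) 2) (by positivity)
  refine ⟨Y, hYc, fun i t ht => ?_⟩
  refine tendsto_nhds_unique (hY i t ht) (tendsto_const_nhds.add ?_)
  have hsub : ∀ s, s ∈ Set.uIoc 0 t → s ∈ Set.Icc 0 T := fun s hs => by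
    rw [Set.uIoc_of_le ht.1] at hs
    exact ⟨hs.1.le, hs.2.trans ht.2⟩
  exact intervalIntegral.tendsto_integral_filter_of_dominated_convergence
    (fun _ => ∑ e ∈ Finset.range (2 * (i + 1)), shellBound κ e R)
    (Eventually.of_forall fun k => (measurable_shellSpeed κ _ y i).aestronglyMeasurable)
    (Eventually.of_forall fun k => Eventually.of_forall fun s hs =>
      (Real.norm_eq_abs _).trans_le (hspeedle (φ k) i s (hsub s hs)))
    intervalIntegrable_const
    (Eventually.of_forall fun s hs => hspeed i s (hsub s hs))

lemma lintegral_shellBound_sq_ne_top (γ : Measure ℝ) [IsGaussian γ] (κ : ℕ → ℝ) (e : ℕ) :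
    ∫⁻ x, ENNReal.ofReal (shellBound κ e x ^ 2) ∂(Measure.infinitePi fun _ : ℕ => γ) ≠ ⊤ := by
  have hx : ∀ k : ℕ, MemLp (fun x : ℕ → ℝ => |x k|) 4 (Measure.infinitePi fun _ : ℕ => γ) :=
    fun k => ((IsGaussian.memLp_id γ 4 (by simp)).comp_measurePreserving
      (measurePreserving_eval_infinitePi (fun _ : ℕ => γ) k)).norm
  have hS := (((hx (e / 2)).add (hx (e / 2 + 1))).add (hx (e / 2 + 2))).integrable_norm_pow
    (p := 4) (by norm_num)
  have hI : Integrable (fun x => shellBound κ e x ^ 2) (Measure.infinitePi fun _ : ℕ => γ) := by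
    refine (hS.const_mul ((2 * |κ (e / 2)|) ^ 2)).congr (Filter.Eventually.of_forall fun x => ?_)
    simp only [Pi.add_apply, Real.norm_eq_abs, shellBound]
    rw [abs_of_nonneg (a := |x (e / 2)| + |x (e / 2 + 1)| + |x (e / 2 + 2)|) (by positivity)]
    ring
  exact hI.lintegral_lt_top.ne

lemma measurePreserving_shellPath (γ : Measure ℝ) [IsGaussian γ] (hγ : ∫ x, x ∂γ = 0) (κ : ℕ → ℝ)
    (h : ℝ) (e : ℕ) (s : ℝ) :
    MeasurePreserving (fun y => shellPath κ h y e s) (Measure.infinitePi fun _ : ℕ => γ)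
      (Measure.infinitePi fun _ : ℕ => γ) :=
  (measurePreserving_shellSweep γ hγ κ h e).comp
    ((measurePreserving_shellCycle γ hγ κ h).iterate _)

lemma lintegral_lintegral_comp_measurePreserving {α β : Type*} [MeasurableSpace α]
    [MeasurableSpace β] {P : Measure α} {ν : Measure β} [SFinite P] [SFinite ν] {F : β → α → α}
    (hFm : Measurable fun p : β × α => F p.1 p.2) (hF : ∀ s, MeasurePreserving (F s) P P)
    {f : α → ENNReal} (hf : Measurable f) :
    ∫⁻ y, ∫⁻ s, f (F s y) ∂ν ∂P = ν Set.univ * ∫⁻ x, f x ∂P := by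
  have hswap : Measurable (Function.uncurry fun y s => f (F s y)) :=
    (hf.comp hFm).comp measurable_swap
  rw [lintegral_lintegral_swap hswap.aemeasurable]
  simp only [fun s => (hF s).lintegral_comp hf, lintegral_const]
  rw [mul_comm]

open Filter in
lemma ae_exists_bounded_subseq (γ : Measure ℝ) [IsGaussian γ] (hγ : ∫ x, x ∂γ = 0) (κ : ℕ → ℝ)
    (T : ℝ) (h : ℕ → ℝ) :
    ∀ᵐ y ∂(Measure.infinitePi fun _ : ℕ => γ), ∃ ψ : ℕ → ℕ, StrictMono ψ ∧
      ∃ C : ℕ → ℝ, (∀ e, 0 ≤ C e) ∧ ∀ N e, ∫⁻ s in Set.Icc 0 T,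
        ENNReal.ofReal (shellBound κ e (shellPath κ (h (ψ N)) y e s) ^ 2)
          ≤ ENNReal.ofReal (C e) := by
  set P := Measure.infinitePi fun _ : ℕ => γ with hP
  obtain ⟨δ, hδ, hδsum⟩ := ENNReal.exists_pos_tsum_mul_lt_of_countable one_ne_zero
    (fun e => ∫⁻ x, ENNReal.ofReal (shellBound κ e x ^ 2) ∂P)
    (lintegral_shellBound_sq_ne_top γ κ)
  have hfm : ∀ e, Measurable fun x : ℕ → ℝ => ENNReal.ofReal (shellBound κ e x ^ 2) := fun e =>
    ((continuous_shellBound κ e).measurable.pow_const 2).ennreal_ofReal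
  set I : ℕ → ℕ → (ℕ → ℝ) → ENNReal := fun N e y => ∫⁻ s in Set.Icc 0 T,
    ENNReal.ofReal (shellBound κ e (shellPath κ (h N) y e s) ^ 2) with hI
  have hjoint : ∀ N e, Measurable fun p : ℝ × (ℕ → ℝ) =>
      ENNReal.ofReal (shellBound κ e (shellPath κ (h N) p.2 e p.1) ^ 2) := fun N e =>
    (hfm e).comp (measurable_shellPath κ (h N) e)
  have hIm : ∀ N e, Measurable (I N e) := fun N e => (hjoint N e).lintegral_prod_left'
  have hIint : ∀ N e, ∫⁻ y, I N e y ∂P = volume (Set.Icc 0 T) *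
      ∫⁻ x, ENNReal.ofReal (shellBound κ e x ^ 2) ∂P := by
    intro N e
    have := lintegral_lintegral_comp_measurePreserving (ν := volume.restrict (Set.Icc 0 T))
      (measurable_shellPath κ (h N) e) (measurePreserving_shellPath γ hγ κ (h N) e) (hfm e)
    rwa [Measure.restrict_apply_univ] at this
  set G : ℕ → (ℕ → ℝ) → ENNReal := fun N y => ∑' e, δ e * I N e y with hG
  have hGm : ∀ N, Measurable (G N) := fun N =>
    Measurable.tsum fun e => (hIm N e).const_mul _
  have hGint : ∀ N, ∫⁻ y, G N y ∂P ≤ volume (Set.Icc 0 T) := by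
    intro N
    simp only [hG]
    rw [lintegral_tsum fun e => ((hIm N e).const_mul _).aemeasurable]
    simp only [lintegral_const_mul _ (hIm N _), hIint]
    calc ∑' e, (δ e : ENNReal) * (volume (Set.Icc 0 T) *
          ∫⁻ x, ENNReal.ofReal (shellBound κ e x ^ 2) ∂P)
        = volume (Set.Icc 0 T) * ∑' e, (∫⁻ x, ENNReal.ofReal (shellBound κ e x ^ 2) ∂P) * δ e := by
          rw [← ENNReal.tsum_mul_left]
          exact tsum_congr fun e => by ring
      _ ≤ volume (Set.Icc 0 T) * 1 := by gcongr
      _ = _ := mul_one _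
  have hfatou : ∫⁻ y, liminf (fun N => G N y) atTop ∂P ≠ ⊤ := by
    refine ne_top_of_le_ne_top (b := volume (Set.Icc 0 T)) (by simp) ?_
    refine (lintegral_liminf_le hGm).trans ?_
    exact (liminf_le_liminf (Eventually.of_forall hGint)).trans (by simp)
  filter_upwards [ae_lt_top (Measurable.liminf hGm) hfatou] with y hy
  obtain ⟨b, hb1, hb2⟩ := exists_between hy
  obtain ⟨ψ, hψ, hψb⟩ := extraction_of_frequently_atTop
    (frequently_lt_of_liminf_lt (by isBoundedDefault) hb1)
  refine ⟨ψ, hψ, fun e => (b / δ e).toReal, fun e => ENNReal.toReal_nonneg, fun N e => ?_⟩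
  have hδ0 : (δ e : ENNReal) ≠ 0 := by simpa using (hδ e).ne'
  rw [ENNReal.ofReal_toReal (ENNReal.div_ne_top hb2.ne hδ0),
    ENNReal.le_div_iff_mul_le (Or.inl hδ0) (Or.inl ENNReal.coe_ne_top), mul_comm]
  exact (ENNReal.le_tsum e).trans (hψb N).le

/-- for `μ_r`-almost every initial condition `x̄ ∈ ℝ^{ℕ≥1}` there exists a
componentwise solution of the infinite mixed shell model on `[0,T]`.  Here `μ_r` is the
infinite product Gaussian measure `⊗_{n≥1} N(0,r²)` on `ℝ^{ℕ≥1}` (identified with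
`ℕ → ℝ`, the coordinate of index `i` being the component `i+1`), characterized as the
(unique) probability measure whose finite-dimensional marginals are products of
`N(0,r²)`. -/
theorem ae_initial_condition_solution_exists (lam r T : ℝ)
    (hlam : 1 < lam) (hr : 0 < r) (hT : 0 < T)
    (μ : Measure (ℕ → ℝ)) (hμ : IsProbabilityMeasure μ)
    (hmarg : ∀ m : ℕ,
      Measure.map (fun y : ℕ → ℝ => fun i : Fin m => y i) μ
        = Measure.pi fun _ : Fin m => gaussianReal 0 (r ^ 2).toNNReal) :
    ∀ᵐ y ∂μ, ∃ X : ℕ → ℝ → ℝ,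
      IsCwShellSolution lam T (fun n => y (n - 1)) X := by
  rw [eq_infinitePi_of_map_fin hmarg]
  have hmean : ∫ x, x ∂(gaussianReal 0 (r ^ 2).toNNReal) = 0 := integral_id_gaussianReal
  filter_upwards [ae_exists_bounded_subseq _ hmean (fun m => lam ^ (m + 2)) (T + 1)
    (fun N => 1 / ((N : ℝ) + 1))] with y hy
  obtain ⟨ψ, hψ, C, hC, hb⟩ := hy
  obtain ⟨Y, hYc, hY⟩ := exists_shellDrift_solution hT.le (h := fun N => 1 / ((ψ N : ℝ) + 1))
    (fun N => by positivity)
    (fun N => by rw [div_le_one (by positivity)]; linarith [(Nat.cast_nonneg (ψ N) : (0 : ℝ) ≤ _)])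
    ((tendsto_one_div_add_atTop_nhds_zero_nat (𝕜 := ℝ)).comp hψ.tendsto_atTop) hC hb
  exact ⟨_, isCwShellSolution_of_shellDrift hYc hY⟩
end

section
/- Consider an infinite eddy tree: a countable set J of nodes with root o, parent map j ↦ \bar j (with \bar o = o), generation function |·| : J → ℕ with |o| = 0 and |j| = |\bar j| + 1 for j ≠ o, and offspring sets O_j = {k ∈ J : k ≠ o, \bar k = j}, each of cardinality at most M for a fixed M ∈ ℕ. Let λ > 1, α, β ∈ ℝ, and let c, d : J → ℝ satisfy c_o = d_o = 0, c_j = λ for |j| = 1, c_j = λ c_{\bar j} for |j| ≥ 2, and α c_j − β d_j = 0 for every j ≠ o. Then for every T > 0 and every initial condition x̄ : J → ℝ with ∑_{j ∈ J} x̄_j² < ∞, there exists a family of continuous functions X_j : [0,T] → ℝ (j ∈ J) with X_j(0) = x̄_j such that for every j ∈ J and t ∈ [0,T]: X_j(t) = x̄_j + ∫_0^t [ α ( c_j X_{\bar j}(s)² − ∑_{k ∈ O_j} c_k X_j(s) X_k(s) ) − β ( d_{\bar j} X_{\bar j}(s) X_j(s) − ∑_{k ∈ O_j} d_j X_k(s)²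 ) ] ds. -/
open Set Filter Topology

/-- A `C¹` vector field on `ℝ^ι` which preserves the Euclidean energy `∑ xᵢ²` and grows at most
linearly with the energy has solutions on every interval `[0, T]`, along which the energy is
constant. -/
theorem exists_solution_of_energy_conserving {ι : Type*} [Fintype ι]
    (B : (ι → ℝ) → ι → ℝ) (hB : ContDiff ℝ 1 B) (C : ℝ)
    (hC : ∀ x, ‖B x‖ ≤ C * ∑ i, x i ^ 2) (hcons : ∀ x, ∑ i, x i * B x i = 0)
    (x₀ : ι → ℝ) {T : ℝ} (hT : 0 ≤ T) :
    ∃ x : ℝ → ι → ℝ, x 0 = x₀ ∧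
      (∀ t ∈ Icc 0 T, HasDerivWithinAt x (B (x t)) (Icc 0 T) t) ∧
      ∀ t ∈ Icc 0 T, ∑ i, x t i ^ 2 = ∑ i, x₀ i ^ 2 := by
  set E : (ι → ℝ) → ℝ := fun x => ∑ i, x i ^ 2 with hE
  have hE0 : ∀ x, 0 ≤ E x := fun x => Finset.sum_nonneg fun i _ => sq_nonneg _
  -- a bounded field which agrees with `B` on the energy level of `x₀`
  set f : (ι → ℝ) → ι → ℝ := fun x => ((1 + E x₀) / (1 + E x)) • B x with hf
  have hEsmooth : ContDiff ℝ 1 E := by fun_prop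
  have hfsmooth : ContDiff ℝ 1 f :=
    (contDiff_const.div (contDiff_const.add hEsmooth)
      fun x => by have := hE0 x; positivity).smul hB
  set L : NNReal := ⟨(1 + E x₀) * |C|, by have := hE0 x₀; positivity⟩ with hL
  have hfL : ∀ x, ‖f x‖ ≤ L := by
    intro x
    have h0 := hE0 x₀
    have h1 := hE0 x
    have h2 : ‖B x‖ ≤ |C| * (1 + E x) := by
      refine (hC x).trans ?_
      have := le_abs_self C
      have := abs_nonneg C
      change C * E x ≤ _
      nlinarith
    rw [hf, norm_smul, Real.norm_of_nonneg (by positivity)]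
    change _ ≤ (1 + E x₀) * |C|
    rw [div_mul_eq_mul_div, div_le_iff₀ (by positivity)]
    calc (1 + E x₀) * ‖B x‖ ≤ (1 + E x₀) * (|C| * (1 + E x)) := by gcongr
      _ = _ := by ring
  set a : NNReal := L * ⟨T, hT⟩ with ha
  obtain ⟨K, hK⟩ := hfsmooth.contDiffOn.exists_lipschitzOnWith one_ne_zero
    (convex_closedBall x₀ (a : ℝ)) (isCompact_closedBall x₀ (a : ℝ))
  have hPL : IsPicardLindelof (fun _ => f) (⟨0, le_rfl, hT⟩ : Icc (0 : ℝ) T) x₀ a 0 L K :=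
    { lipschitzOnWith := fun _ _ => hK
      continuousOn := fun _ _ => continuousOn_const
      norm_le := fun _ _ x _ => hfL x
      mul_max_le := by
        simp only [sub_zero, sub_self, max_eq_left hT, NNReal.coe_zero]
        exact le_rfl }
  obtain ⟨x, hx0, hx⟩ := hPL.exists_eq_forall_mem_Icc_hasDerivWithinAt₀
  have hx0 : x 0 = x₀ := hx0
  have hxE : ∀ t ∈ Icc 0 T, HasDerivWithinAt (fun t => E (x t)) 0 (Icc 0 T) t := by
    intro t ht
    have h := HasDerivWithinAt.fun_sum (u := Finset.univ) fun i _ =>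
      (hasDerivWithinAt_pi.1 (hx t ht) i).pow 2
    refine h.congr_deriv ?_
    rw [← mul_zero (2 * ((1 + E x₀) / (1 + E (x t)))), ← hcons (x t), Finset.mul_sum]
    refine Finset.sum_congr rfl fun i _ => ?_
    simp only [hf, Pi.smul_apply, smul_eq_mul]
    push_cast
    ring
  have hxconst : ∀ t ∈ Icc 0 T, E (x t) = E x₀ := by
    intro t ht
    have h := (convex_Icc (0 : ℝ) T).norm_image_sub_le_of_norm_hasDerivWithin_le (C := 0)
      hxE (fun _ _ => by simp) (left_mem_Icc.2 hT) ht
    rw [zero_mul, norm_le_zero_iff, sub_eq_zero, hx0] at h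
    exact h
  refine ⟨x, hx0, fun t ht => ?_, hxconst⟩
  have h := hx t ht
  have h0 := hE0 x₀
  simp only [hf] at h
  rwa [hxconst t ht, div_self (by positivity), one_smul] at h

/-- The functions on the line with a common bound and a common Lipschitz constant form a compact
set for the compact-open topology. -/
theorem isCompact_setOf_bounded_lipschitz (R : ℝ) (L : NNReal) :
    IsCompact {f : C(ℝ, ℝ) | (∀ t, f t ∈ Icc (-R) R) ∧ LipschitzWith L f} := by
  refine ArzelaAscoli.isCompact_of_equicontinuous _ ?_ ?_
  · have himage : ContinuousMap.toFun ''
        {f : C(ℝ, ℝ) | (∀ t, f t ∈ Icc (-R) R) ∧ LipschitzWith L f} =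
        (univ.pi fun _ => Icc (-R) R) ∩ {f : ℝ → ℝ | LipschitzWith L f} := by
      ext f
      constructor
      · rintro ⟨g, ⟨hg, hg'⟩, rfl⟩
        exact ⟨fun t _ => hg t, hg'⟩
      · rintro ⟨hf, hf'⟩
        exact ⟨⟨f, hf'.continuous⟩, ⟨fun t => hf t (mem_univ t), hf'⟩, rfl⟩
    rw [himage]
    refine (isCompact_univ_pi fun _ => isCompact_Icc).inter_right ?_
    simp only [lipschitzWith_iff_dist_le_mul, ofPred_forall]
    exact isClosed_iInter fun s => isClosed_iInter fun t =>
      isClosed_le (by fun_prop) continuous_const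
  · exact (LipschitzWith.uniformEquicontinuous _ L fun f => f.2.2).equicontinuous

/-- Extension by zero of a vector indexed by a finite set of nodes. -/
noncomputable def extendZero {J : Type*} (F : Finset J) (x : F → ℝ) : J → ℝ :=
  Function.extend Subtype.val x fun _ => 0

theorem extendZero_of_mem {J : Type*} {F : Finset J} (x : F → ℝ) {j : J} (hj : j ∈ F) :
    extendZero F x j = x ⟨j, hj⟩ :=
  Subtype.val_injective.extend_apply x _ ⟨j, hj⟩

theorem extendZero_of_notMem {J : Type*} {F : Finset J} (x : F → ℝ) {j : J} (hj : j ∉ F) :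
    extendZero F x j = 0 :=
  Function.extend_apply' x _ j fun ⟨i, hi⟩ => hj (hi ▸ i.2)

theorem contDiff_extendZero {J : Type*} (F : Finset J) (j : J) :
    ContDiff ℝ 1 fun x : F → ℝ => extendZero F x j := by
  by_cases hj : j ∈ F
  · simpa only [extendZero_of_mem _ hj] using contDiff_apply ℝ ℝ (⟨j, hj⟩ : F)
  · simpa only [extendZero_of_notMem _ hj] using contDiff_const

theorem sq_extendZero_le {J : Type*} {F : Finset J} (x : F → ℝ) (j : J) :
    extendZero F x j ^ 2 ≤ ∑ i, x i ^ 2 := by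
  by_cases hj : j ∈ F
  · rw [extendZero_of_mem _ hj]
    exact Finset.single_le_sum (f := fun i : F => x i ^ 2) (fun i _ => sq_nonneg _)
      (Finset.mem_univ _)
  · rw [extendZero_of_notMem _ hj]
    simpa using Finset.sum_nonneg fun (i : F) _ => sq_nonneg (x i)

/-- The vector field of the tree model, with `O j` the offspring set of the node `j`. -/
def eddyField {J : Type*} (parent : J → J) (O : J → Finset J) (c d : J → ℝ) (α β : ℝ)
    (v : J → ℝ) (j : J) : ℝ :=
  α * (c j * v (parent j) ^ 2 - ∑ k ∈ O j, c k * v j * v k)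
    - β * (d (parent j) * v (parent j) * v j - ∑ k ∈ O j, d j * v k ^ 2)

theorem abs_eddyField_le {J : Type*} (parent : J → J) (O : J → Finset J) (c d : J → ℝ)
    (α β : ℝ) {v : J → ℝ} {E : ℝ} (hv : ∀ j, v j ^ 2 ≤ E) (j : J) :
    |eddyField parent O c d α β v j| ≤
      (|α| * (|c j| + ∑ k ∈ O j, |c k|) + |β| * (|d (parent j)| + ∑ _k ∈ O j, |d j|)) * E := by
  have hvv : ∀ i k, |v i * v k| ≤ E := fun i k => by
    rw [abs_le]
    constructor <;> nlinarith [hv i, hv k, sq_nonneg (v i + v k), sq_nonneg (v i - v k)]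
  have hterm : ∀ a i k, |a * v i * v k| ≤ |a| * E := fun a i k => by
    rw [mul_assoc, abs_mul]
    exact mul_le_mul_of_nonneg_left (hvv i k) (abs_nonneg a)
  have hsq : ∀ a i, |a * v i ^ 2| ≤ |a| * E := fun a i => by
    simpa only [sq, mul_assoc] using hterm a i i
  have h1 : |c j * v (parent j) ^ 2 - ∑ k ∈ O j, c k * v j * v k| ≤
      (|c j| + ∑ k ∈ O j, |c k|) * E := by
    rw [add_mul, Finset.sum_mul]
    exact (abs_sub _ _).trans (add_le_add (hsq _ _)
      ((Finset.abs_sum_le_sum_abs _ _).trans (Finset.sum_le_sum fun k _ => hterm _ _ _)))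
  have h2 : |d (parent j) * v (parent j) * v j - ∑ k ∈ O j, d j * v k ^ 2| ≤
      (|d (parent j)| + ∑ _k ∈ O j, |d j|) * E := by
    rw [add_mul, Finset.sum_mul]
    exact (abs_sub _ _).trans (add_le_add (hterm _ _ _)
      ((Finset.abs_sum_le_sum_abs _ _).trans (Finset.sum_le_sum fun k _ => hsq _ _)))
  rw [add_mul, mul_assoc, mul_assoc]
  refine (abs_sub _ _).trans ?_
  rw [abs_mul, abs_mul]
  gcongr

/-- The tree model preserves the energy of every finitely supported configuration. -/
theorem sum_mul_eddyField_eq_zero {J : Type*} {root : J} {parent : J → J} {O : J → Finset J}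
    (hroot : parent root = root) (hO : ∀ j k, k ∈ O j ↔ k ≠ root ∧ parent k = j)
    {c d : J → ℝ} (hc : c root = 0) (hd : d root = 0) (α β : ℝ)
    {F : Finset J} {v : J → ℝ} (hv : ∀ j, j ∉ F → v j = 0) :
    ∑ j ∈ F, v j * eddyField parent O c d α β v j = 0 := by
  classical
  set h : J → J → ℝ := fun j k => v j * (β * (d j * v k ^ 2) - α * (c k * v j * v k)) with hh
  have hswap : ∑ j ∈ F, ∑ k ∈ O j, h j k = ∑ k ∈ F, h (parent k) k := by
    have hinner : ∀ j, ∑ k ∈ O j, h j k =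
        ∑ k ∈ F, if k ≠ root ∧ parent k = j then h j k else 0 := by
      intro j
      rw [← Finset.sum_filter]
      refine (Finset.sum_subset (fun k hk => (hO j k).2 (Finset.mem_filter.1 hk).2) ?_).symm
      intro k hk hk'
      have hkF : k ∉ F := fun hkF => hk' (Finset.mem_filter.2 ⟨hkF, (hO j k).1 hk⟩)
      simp [hh, hv k hkF]
    simp only [hinner]
    rw [Finset.sum_comm]
    refine Finset.sum_congr rfl fun k _ => ?_
    by_cases hk : k = root
    · simp [hk, hh, hroot, hc, hd]
    · simp only [ne_eq, hk, not_false_eq_true, true_and, Finset.sum_ite_eq]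
      split_ifs with hp
      · rfl
      · simp [hh, hv _ hp]
  have hsplit : ∀ j, v j * eddyField parent O c d α β v j =
      ∑ k ∈ O j, h j k - h (parent j) j := by
    intro j
    simp only [hh, eddyField, ← Finset.mul_sum, Finset.sum_sub_distrib]
    ring
  rw [Finset.sum_congr rfl fun j _ => hsplit j, Finset.sum_sub_distrib, hswap, sub_self]

/-- The truncation of the tree model to a finite set `F` of nodes has a solution on `[0, T]`,
here extended to a curve on the line which is constant outside `[0, T]`. It satisfies bounds
which do not depend on `F`. -/
theorem exists_truncated_solution {J : Type*} {root : J} {parent : J → J} {O : J → Finset J}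
    (hroot : parent root = root) (hO : ∀ j k, k ∈ O j ↔ k ≠ root ∧ parent k = j)
    {c d : J → ℝ} (hc : c root = 0) (hd : d root = 0) (α β : ℝ)
    {T : ℝ} (hT : 0 ≤ T) {xbar : J → ℝ} {E : ℝ} (F : Finset J)
    (hE : ∑ j ∈ F, xbar j ^ 2 ≤ E) :
    ∃ X : J → C(ℝ, ℝ),
      (∀ j, (∀ t, X j t ∈ Icc (-√E) (√E)) ∧ LipschitzWith (Real.toNNReal
        ((|α| * (|c j| + ∑ k ∈ O j, |c k|) + |β| * (|d (parent j)| + ∑ _k ∈ O j, |d j|)) * E))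
        (X j)) ∧
      ∀ j ∈ F, ∀ t ∈ Icc 0 T, X j t = xbar j +
        ∫ s in (0 : ℝ)..t, eddyField parent O c d α β (fun i => X i s) j := by
  set G := eddyField parent O c d α β with hG
  set K : J → ℝ := fun j =>
    |α| * (|c j| + ∑ k ∈ O j, |c k|) + |β| * (|d (parent j)| + ∑ _k ∈ O j, |d j|) with hK
  have hK0 : ∀ j, 0 ≤ K j := fun j => by positivity
  obtain ⟨x, hx0, hx, hxE⟩ := exists_solution_of_energy_conserving
    (fun (x : F → ℝ) (i : F) => G (extendZero F x) i)
    (contDiff_pi.2 fun i => by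
      have := contDiff_extendZero F
      simp only [hG, eddyField]
      fun_prop)
    (∑ i : F, K i)
    (fun x => by
      have hsum : 0 ≤ ∑ i, x i ^ 2 := Finset.sum_nonneg fun i _ => sq_nonneg _
      have hsumK : 0 ≤ ∑ i : F, K i := Finset.sum_nonneg fun i _ => hK0 i
      refine (pi_norm_le_iff_of_nonneg (mul_nonneg hsumK hsum)).2 fun i => ?_
      refine (abs_eddyField_le parent O c d α β (sq_extendZero_le x) i).trans ?_
      exact mul_le_mul_of_nonneg_right
        (Finset.single_le_sum (f := fun i : F => K i) (fun i _ => hK0 i) (Finset.mem_univ i)) hsum)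
    (fun x => by
      have h := sum_mul_eddyField_eq_zero hroot hO hc hd α β (F := F) (v := extendZero F x)
        fun j hj => extendZero_of_notMem x hj
      rw [← Finset.sum_coe_sort] at h
      simpa only [extendZero_of_mem _ (Subtype.prop _)] using h)
    (fun i => xbar i) hT
  have hxE' : ∀ t ∈ Icc 0 T, ∀ j, extendZero F (x t) j ^ 2 ≤ E := by
    intro t ht j
    refine (sq_extendZero_le _ j).trans ?_
    rw [hxE t ht]
    rwa [← Finset.sum_coe_sort] at hE
  have hderiv : ∀ j ∈ F, ∀ t ∈ Icc 0 T,
      HasDerivWithinAt (fun t => extendZero F (x t) j) (G (extendZero F (x t)) j) (Icc 0 T) t := by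
    intro j hj t ht
    simpa only [extendZero_of_mem _ hj] using hasDerivWithinAt_pi.1 (hx t ht) ⟨j, hj⟩
  have hlip : ∀ j, LipschitzOnWith (Real.toNNReal (K j * E))
      (fun t => extendZero F (x t) j) (Icc 0 T) := by
    intro j
    by_cases hj : j ∈ F
    · refine (convex_Icc 0 T).lipschitzOnWith_of_nnnorm_hasDerivWithin_le (hderiv j hj) ?_
      intro t ht
      rw [← NNReal.coe_le_coe, coe_nnnorm, Real.norm_eq_abs]
      exact (abs_eddyField_le parent O c d α β (hxE' t ht) j).trans (Real.le_coe_toNNReal _)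
    · simp only [extendZero_of_notMem _ hj]
      exact (LipschitzWith.const' 0).lipschitzOnWith
  have hY : ∀ j, LipschitzWith (Real.toNNReal (K j * E))
      fun t => extendZero F (x (projIcc 0 T hT t)) j := by
    intro j
    have := (hlip j).to_restrict.comp (LipschitzWith.projIcc hT)
    rwa [mul_one] at this
  refine ⟨fun j => ⟨_, (hY j).continuous⟩, fun j => ⟨fun t => ?_, hY j⟩, ?_⟩
  · exact abs_le.1 (Real.abs_le_sqrt (hxE' _ (projIcc 0 T hT t).2 j))
  · intro j hj t ht
    have hsub : Icc 0 t ⊆ Icc 0 T := Icc_subset_Icc_right ht.2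
    have hcont : Continuous fun s =>
        G (fun i => extendZero F (x (projIcc 0 T hT s)) i) j := by
      have := fun j => (hY j).continuous
      simp only [hG, eddyField]
      fun_prop
    have hint : ∫ s in (0 : ℝ)..t, G (fun i => extendZero F (x (projIcc 0 T hT s)) i) j =
        extendZero F (x t) j - extendZero F (x 0) j := by
      refine intervalIntegral.integral_eq_sub_of_hasDerivAt_of_le ht.1
        (f := fun s => extendZero F (x s) j) ((hlip j).continuousOn.mono hsub) ?_
        (hcont.intervalIntegrable _ _)
      intro s hs
      have hsT : s ∈ Icc 0 T := hsub (Ioo_subset_Icc_self hs)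
      rw [projIcc_of_mem hT hsT]
      exact (hderiv j hj s hsT).hasDerivAt (Icc_mem_nhds hs.1 (hs.2.trans_le ht.2))
    change extendZero F (x (projIcc 0 T hT t)) j = xbar j +
      ∫ s in (0 : ℝ)..t, G (fun i => extendZero F (x (projIcc 0 T hT s)) i) j
    rw [hint, projIcc_of_mem hT ht, hx0, extendZero_of_mem (fun i : F => xbar i) hj]
    ring


/-- existence of a componentwise solution of the infinite tree model of
turbulence for every `ℓ²` initial condition.  `J` is a countable eddy tree with root,
parent map, generation function, offspring sets `O_j = {k ≠ root : parent k = j}` of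
cardinality at most `M`; the coefficients satisfy `c_root = d_root = 0`, `c_j = λ` on the
first generation, `c_j = λ c_{\bar j}` from the second generation on, and
`α c_j − β d_j = 0` off the root. -/
theorem infinite_tree_solution_exists {J : Type*} [Countable J]
    (root : J) (parent : J → J) (gen : J → ℕ)
    (hparent_root : parent root = root) (hgen_root : gen root = 0)
    (hgen : ∀ j, j ≠ root → gen j = gen (parent j) + 1)
    (hfin : ∀ j : J, {k : J | k ≠ root ∧ parent k = j}.Finite)
    (M : ℕ) (hM : ∀ j, (hfin j).toFinset.card ≤ M)
    (lam α β : ℝ) (hlam : 1 < lam) (c d : J → ℝ)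
    (hc_root : c root = 0) (hd_root : d root = 0)
    (hc_one : ∀ j, gen j = 1 → c j = lam)
    (hc_rec : ∀ j, 2 ≤ gen j → c j = lam * c (parent j))
    (hconserv : ∀ j, j ≠ root → α * c j - β * d j = 0)
    (T : ℝ) (hT : 0 < T) (xbar : J → ℝ)
    (hl2 : Summable fun j => (xbar j) ^ 2) :
    ∃ X : J → ℝ → ℝ,
      (∀ j, ContinuousOn (X j) (Set.Icc (0 : ℝ) T)) ∧
      (∀ j, X j 0 = xbar j) ∧
      ∀ j, ∀ t ∈ Set.Icc (0 : ℝ) T,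
        X j t = xbar j + ∫ s in (0 : ℝ)..t,
          (α * (c j * (X (parent j) s) ^ 2
              - ∑ k ∈ (hfin j).toFinset, c k * X j s * X k s)
            - β * (d (parent j) * X (parent j) s * X j s
              - ∑ k ∈ (hfin j).toFinset, d j * (X k s) ^ 2)) := by
  have hO : ∀ j k, k ∈ (hfin j).toFinset ↔ k ≠ root ∧ parent k = j := fun j k => by simp
  have hsol := fun F : Finset J => exists_truncated_solution hparent_root hO hc_root hd_root α β
    hT.le F (hl2.sum_le_tsum F fun j _ => sq_nonneg (xbar j))
  choose Y hYmem hYeq using hsol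
  have hcompact := isCompact_univ_pi fun j => isCompact_setOf_bounded_lipschitz
    (√(∑' i, xbar i ^ 2)) (Real.toNNReal
      ((|α| * (|c j| + ∑ k ∈ (hfin j).toFinset, |c k|)
        + |β| * (|d (parent j)| + ∑ _k ∈ (hfin j).toFinset, |d j|)) * ∑' i, xbar i ^ 2))
  set U : Ultrafilter (Finset J) := Ultrafilter.of atTop with hU
  obtain ⟨X, -, hX⟩ := hcompact.ultrafilter_le_nhds (U.map Y)
    (le_principal_iff.2 (mem_map.2 (univ_mem' fun F j _ => hYmem F j)))
  have hX : Tendsto Y U (𝓝 X) := hX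
  have heq : ∀ j, ∀ t ∈ Icc (0 : ℝ) T, X j t = xbar j + ∫ s in (0 : ℝ)..t,
      eddyField parent (fun j => (hfin j).toFinset) c d α β (fun i => X i s) j := by
    intro j t ht
    have heval : ∀ i, Continuous fun p : (J → C(ℝ, ℝ)) × ℝ => p.1 i p.2 := fun i => by fun_prop
    have hrhs : Continuous fun Z : J → C(ℝ, ℝ) => xbar j + ∫ s in (0 : ℝ)..t,
        eddyField parent (fun j => (hfin j).toFinset) c d α β (fun i => Z i s) j := by
      refine continuous_const.add
        (intervalIntegral.continuous_parametric_intervalIntegral_of_continuous' ?_ 0 t)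
      simp only [Function.uncurry_def, eddyField]
      fun_prop
    have hlhs : Continuous fun Z : J → C(ℝ, ℝ) => Z j t := by fun_prop
    refine tendsto_nhds_unique_of_eventuallyEq ((hlhs.tendsto X).comp hX)
      ((hrhs.tendsto X).comp hX) ?_
    have hmem : ∀ᶠ F : Finset J in U, j ∈ F := by
      refine Ultrafilter.of_le atTop ?_
      filter_upwards [eventually_ge_atTop {j}] with F hF using hF (Finset.mem_singleton_self j)
    filter_upwards [hmem] with F hF using hYeq F j hF t ht
  refine ⟨fun j => X j, fun j => (X j).continuous.continuousOn, fun j => ?_, heq⟩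
  simpa using heq j 0 (left_mem_Icc.2 hT.le)
end
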